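/- arXiv:2102.08105 — 2 statements merged into one kernel-verified Lean document; each statement's English description precedes it below -/
import Mathlib

section
/- Fix L > 0, a positive integer N, h = L/N, and parameters ε, η, ξ, α, β, δ > 0. With the grid-function notation below, define for grid functions φ, ρ: E_c(φ,ρ) = h²·Σ_{i,j} [ (1/(4ε))(φ_{i,j} − 1/2)⁴ + 1/(64ε) + (η²/2)(Δ_h φ)_{i,j}² + β·H(ρ_{i,j}) + (α/2)( (ρ_{i,j} − 𝒜|∇_h^δ φ|_{i,j})² + (√2 − 1)ρ_{i,j}² ) ] + (ε/2 + α/(2δ))·‖∇_h φ‖₂² + (ξ/2)·‖∇_h ρ‖₂², E_e(φ,ρ) = h²·Σ_{i,j} [ (1/(8ε))(φ_{i,j} − 1/2)² + (α/2)(√2 − 1)ρ_{i,j}² ] + (α/(2δ))·‖∇_h φ‖₂², and E(φ,ρ) = h²·Σ_{i,j} [ (1/(4ε))φ_{i,j}²(1 − φ_{i,j})² + (η²/2)(Δ_h φ)_{i,j}² + (α/2)(ρ_{i,j} − 𝒜|∇_h^δ φ|_{i,j})² + β·H(ρ_{i,j}) ] + (ε/2)·‖∇_h φ‖₂² + (ξ/2)·‖∇_h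 ρ‖₂². Then: (i) E_c is convex on the convex set S = { (φ,ρ) : 0 < ρ_{i,j} < 1 for all i,j } of pairs of grid functions; (ii) E_e is convex on all pairs of grid functions; (iii) E_c(φ,ρ) − E_e(φ,ρ) = E(φ,ρ) for every (φ,ρ) ∈ S. -/
open scoped BigOperators

noncomputable section

/-- A periodic grid function on the uniform `N × N` grid. -/
abbrev GF (N : ℕ) := ZMod N × ZMod N → ℝ

/-- Forward difference in the `x`-direction: `(D_x u)_{i,j} = (u_{i+1,j} − u_{i,j})/h`. -/
def Dx {N : ℕ} (h : ℝ) (u : GF N) : GF N := fun p => (u (p.1 + 1, p.2) - u p) / h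

/-- Forward difference in the `y`-direction: `(D_y u)_{i,j} = (u_{i,j+1} − u_{i,j})/h`. -/
def Dy {N : ℕ} (h : ℝ) (u : GF N) : GF N := fun p => (u (p.1, p.2 + 1) - u p) / h

/-- Discrete Laplacian:
`(Δ_h u)_{i,j} = (u_{i+1,j} + u_{i−1,j} + u_{i,j+1} + u_{i,j−1} − 4u_{i,j})/h²`. -/
def lap {N : ℕ} (h : ℝ) (u : GF N) : GF N := fun p =>
  (u (p.1 + 1, p.2) + u (p.1 - 1, p.2) + u (p.1, p.2 + 1) + u (p.1, p.2 - 1) - 4 * u p) / h ^ 2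

/-- Averaged regularized gradient magnitude
`𝒜|∇_h^δ u|_{i,j} = √((1/2)[(D_x u)_{i,j}² + (D_x u)_{i−1,j}² + (D_y u)_{i,j}² + (D_y u)_{i,j−1}²] + δ²)`. -/
def aGrad {N : ℕ} (h δ : ℝ) (u : GF N) : GF N := fun p =>
  Real.sqrt ((1 / 2) * ((Dx h u p) ^ 2 + (Dx h u (p.1 - 1, p.2)) ^ 2
    + (Dy h u p) ^ 2 + (Dy h u (p.1, p.2 - 1)) ^ 2) + δ ^ 2)

/-- Discrete gradient norm squared `‖∇_h u‖₂² = h²·Σ_{i,j} ((D_x u)² + (D_y u)²)`. -/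
def gradNormSq {N : ℕ} [NeZero N] (h : ℝ) (u : GF N) : ℝ :=
  h ^ 2 * ∑ p : ZMod N × ZMod N, ((Dx h u p) ^ 2 + (Dy h u p) ^ 2)

/-- Flory–Huggins entropy density `H(s) = s ln s + (1−s) ln(1−s)`. -/
def FH (s : ℝ) : ℝ := s * Real.log s + (1 - s) * Real.log (1 - s)

/-- The discrete energy `E(φ,ρ)`. -/
def energyE {N : ℕ} [NeZero N] (h ε η ξ α β δ : ℝ) (φ ρ : GF N) : ℝ :=
  h ^ 2 * ∑ p : ZMod N × ZMod N,
      ((1 / (4 * ε)) * (φ p) ^ 2 * (1 - φ p) ^ 2 + (η ^ 2 / 2) * (lap h φ p) ^ 2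
        + (α / 2) * (ρ p - aGrad h δ φ p) ^ 2 + β * FH (ρ p))
    + (ε / 2) * gradNormSq h φ + (ξ / 2) * gradNormSq h ρ

/-- The discrete convex energy part `E_c(φ,ρ)`. -/
def energyEc {N : ℕ} [NeZero N] (h ε η ξ α β δ : ℝ) (φ ρ : GF N) : ℝ :=
  h ^ 2 * ∑ p : ZMod N × ZMod N,
      ((1 / (4 * ε)) * (φ p - 1 / 2) ^ 4 + 1 / (64 * ε)
        + (η ^ 2 / 2) * (lap h φ p) ^ 2 + β * FH (ρ p)
        + (α / 2) * ((ρ p - aGrad h δ φ p) ^ 2 + (Real.sqrt 2 - 1) * (ρ p) ^ 2))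
    + (ε / 2 + α / (2 * δ)) * gradNormSq h φ + (ξ / 2) * gradNormSq h ρ

/-- The discrete concave energy part `E_e(φ,ρ)`. -/
def energyEe {N : ℕ} [NeZero N] (h ε α δ : ℝ) (φ ρ : GF N) : ℝ :=
  h ^ 2 * ∑ p : ZMod N × ZMod N,
      ((1 / (8 * ε)) * (φ p - 1 / 2) ^ 2 + (α / 2) * (Real.sqrt 2 - 1) * (ρ p) ^ 2)
    + (α / (2 * δ)) * gradNormSq h φ

theorem convexOn_sq_of_isLinearMap {E : Type*} [AddCommGroup E] [Module ℝ E] {S : Set E}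
    (hS : Convex ℝ S) {f : E → ℝ} (hf : IsLinearMap ℝ f) : ConvexOn ℝ S fun z => f z ^ 2 :=
  ((even_two.convexOn_pow (𝕜 := ℝ)).comp_linearMap (hf.mk' f)).subset (Set.subset_univ _) hS

theorem convexOn_FH : ConvexOn ℝ (Set.Icc 0 1) FH := by
  have h := Real.strictConcave_binEntropy.concaveOn.neg
  refine h.congr fun x _ => ?_
  simp only [Pi.neg_apply, Real.binEntropy, FH, Real.log_inv]
  ring

/-- Half the squared Euclidean norm on `ℝ⁴`. -/
def halfSq (x : Fin 4 → ℝ) : ℝ := 1 / 2 * (x 0 ^ 2 + x 1 ^ 2 + x 2 ^ 2 + x 3 ^ 2)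

theorem halfSq_nonneg (x : Fin 4 → ℝ) : 0 ≤ halfSq x := by unfold halfSq; positivity

theorem halfSq_combo (x y : Fin 4 → ℝ) {a b : ℝ} (hab : a + b = 1) :
    a * halfSq x + b * halfSq y = halfSq (a • x + b • y) + a * b * halfSq (x - y) := by
  obtain rfl : b = 1 - a := by linarith
  simp only [halfSq, Pi.add_apply, Pi.sub_apply, Pi.smul_apply, smul_eq_mul]
  ring

theorem sq_sqrt_halfSq_sub_le (x y : Fin 4 → ℝ) (δ : ℝ) :
    (√(halfSq x + δ ^ 2) - √(halfSq y + δ ^ 2)) ^ 2 ≤ halfSq (x - y) := by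
  have hx : 0 ≤ halfSq x + δ ^ 2 := add_nonneg (halfSq_nonneg x) (sq_nonneg δ)
  have hy : 0 ≤ halfSq y + δ ^ 2 := add_nonneg (halfSq_nonneg y) (sq_nonneg δ)
  have key : 1 / 2 * (x 0 * y 0 + x 1 * y 1 + x 2 * y 2 + x 3 * y 3) + δ ^ 2
      ≤ √(halfSq x + δ ^ 2) * √(halfSq y + δ ^ 2) := by
    rw [← Real.sqrt_mul hx]
    apply Real.le_sqrt_of_sq_le
    simp only [halfSq]
    linarith [sq_nonneg (x 0 * y 1 - x 1 * y 0), sq_nonneg (x 0 * y 2 - x 2 * y 0),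
      sq_nonneg (x 0 * y 3 - x 3 * y 0), sq_nonneg (x 1 * y 2 - x 2 * y 1),
      sq_nonneg (x 1 * y 3 - x 3 * y 1), sq_nonneg (x 2 * y 3 - x 3 * y 2),
      sq_nonneg (δ * (x 0 - y 0)), sq_nonneg (δ * (x 1 - y 1)),
      sq_nonneg (δ * (x 2 - y 2)), sq_nonneg (δ * (x 3 - y 3))]
  have h1 := Real.sq_sqrt hx
  have h2 := Real.sq_sqrt hy
  simp only [halfSq, Pi.sub_apply] at *
  linarith

theorem coupling_combo_le {δ : ℝ} (hδ : 0 < δ) (x y : Fin 4 → ℝ) {r s a b : ℝ}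
    (ha : 0 ≤ a) (hb : 0 ≤ b) (hab : a + b = 1)
    (h0 : 0 ≤ a * r + b * s) (h1 : a * r + b * s ≤ 1) :
    (a * r + b * s - √(halfSq (a • x + b • y) + δ ^ 2)) ^ 2 + halfSq (a • x + b • y) / δ
      ≤ a * ((r - √(halfSq x + δ ^ 2)) ^ 2 + halfSq x / δ)
        + b * ((s - √(halfSq y + δ ^ 2)) ^ 2 + halfSq y / δ) := by
  have hcombo := halfSq_combo x y hab
  have hlip := sq_sqrt_halfSq_sub_le x y δ
  have hA : ∀ v, √(halfSq v + δ ^ 2) ^ 2 = halfSq v + δ ^ 2 := fun v =>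
    Real.sq_sqrt (add_nonneg (halfSq_nonneg v) (sq_nonneg δ))
  have hδA : ∀ v, δ ≤ √(halfSq v + δ ^ 2) := fun v =>
    Real.le_sqrt_of_sq_le (by linarith [halfSq_nonneg v])
  have hx := hA x
  have hy := hA y
  have hz := hA (a • x + b • y)
  have hδx := hδA x
  have hδy := hδA y
  have hδz := hδA (a • x + b • y)
  have hd := halfSq_nonneg (x - y)
  generalize √(halfSq x + δ ^ 2) = A at *
  generalize √(halfSq y + δ ^ 2) = B at *
  generalize √(halfSq (a • x + b • y) + δ ^ 2) = C at *
  generalize halfSq x = p at *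
  generalize halfSq y = q at *
  generalize halfSq (a • x + b • y) = m at *
  generalize halfSq (x - y) = d at *
  have hab0 : 0 ≤ a * b := mul_nonneg ha hb
  have hp : p / δ * a + q / δ * b = m / δ + a * b * d / δ := by
    rw [← add_div, ← hcombo]; ring
  have hbδ : 0 ≤ a * b * d / δ := by positivity
  have hdiv : a * b * d / δ * δ = a * b * d := div_mul_cancel₀ _ hδ.ne'
  have hmean : δ ≤ a * A + b * B := by
    calc δ = a * δ + b * δ := by rw [← add_mul, hab, one_mul]
      _ ≤ _ := by gcongr
  have hsq : (a * A + b * B) ^ 2 + a * b * (A - B) ^ 2 = C ^ 2 + a * b * d := by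
    obtain rfl : b = 1 - a := by linarith
    linear_combination a * hx + (1 - a) * hy - hz + hcombo
  -- the averaged root exceeds the root of the average by at most the second-order defect
  have hjensen : 2 * (a * A + b * B - C) ≤ a * b * d / δ := by
    by_contra! hlt
    have hpos : 0 < a * A + b * B - C := by linarith
    have : a * b * d < 2 * (a * A + b * B - C) * δ := by
      rw [← hdiv]; exact mul_lt_mul_of_pos_right hlt hδ
    nlinarith [mul_nonneg hab0 (sq_nonneg (A - B))]
  have hweighted : 2 * (a * r + b * s) * (a * A + b * B - C) ≤ a * b * d / δ := by
    calc 2 * (a * r + b * s) * (a * A + b * B - C)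
        = (a * r + b * s) * (2 * (a * A + b * B - C)) := by ring
      _ ≤ (a * r + b * s) * (a * b * d / δ) := mul_le_mul_of_nonneg_left hjensen h0
      _ ≤ a * b * d / δ := mul_le_of_le_one_left hbδ h1
  have hcross : 0 ≤ a * b * ((r - s) ^ 2 - 2 * (r - s) * (A - B) + d) :=
    mul_nonneg hab0 (by nlinarith [sq_nonneg (r - s - (A - B))])
  obtain rfl : b = 1 - a := by linarith
  linarith

theorem convexOn_coupling {E : Type*} [AddCommGroup E] [Module ℝ E] {S : Set E}
    (hS : Convex ℝ S) {δ : ℝ} (hδ : 0 < δ) {f : E → Fin 4 → ℝ} (hf : IsLinearMap ℝ f)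
    {g : E → ℝ} (hg : IsLinearMap ℝ g) (hgS : ∀ z ∈ S, 0 ≤ g z ∧ g z ≤ 1) :
    ConvexOn ℝ S fun z => (g z - √(halfSq (f z) + δ ^ 2)) ^ 2 + halfSq (f z) / δ := by
  refine ⟨hS, fun z hz w hw a b ha hb hab => ?_⟩
  have h := hgS _ (hS hz hw ha hb hab)
  simp only [hf.map_add, hf.map_smul, hg.map_add, hg.map_smul, smul_eq_mul] at h ⊢
  exact coupling_combo_le hδ _ _ ha hb hab h.1 h.2

theorem isLinearMap_Dx {N : ℕ} (h : ℝ) (p : ZMod N × ZMod N) :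
    IsLinearMap ℝ fun u : GF N => Dx h u p := by
  constructor <;> intros <;> simp [Dx] <;> ring

theorem isLinearMap_Dy {N : ℕ} (h : ℝ) (p : ZMod N × ZMod N) :
    IsLinearMap ℝ fun u : GF N => Dy h u p := by
  constructor <;> intros <;> simp [Dy] <;> ring

theorem isLinearMap_lap {N : ℕ} (h : ℝ) (p : ZMod N × ZMod N) :
    IsLinearMap ℝ fun u : GF N => lap h u p := by
  constructor <;> intros <;> simp [lap] <;> ring

/-- The four one-sided differences of `u` adjacent to a grid point. -/
def stencil {N : ℕ} (h : ℝ) (u : GF N) (p : ZMod N × ZMod N) : Fin 4 → ℝ :=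
  ![Dx h u p, Dx h u (p.1 - 1, p.2), Dy h u p, Dy h u (p.1, p.2 - 1)]

theorem isLinearMap_stencil {N : ℕ} (h : ℝ) (p : ZMod N × ZMod N) :
    IsLinearMap ℝ fun u : GF N => stencil h u p := by
  constructor <;> intros <;> ext i <;> fin_cases i <;>
    simp [stencil, (isLinearMap_Dx h _).map_add, (isLinearMap_Dy h _).map_add,
      (isLinearMap_Dx h _).map_smul, (isLinearMap_Dy h _).map_smul]

theorem aGrad_eq_sqrt_halfSq {N : ℕ} (h δ : ℝ) (u : GF N) (p : ZMod N × ZMod N) :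
    aGrad h δ u p = √(halfSq (stencil h u p) + δ ^ 2) := by
  simp [aGrad, halfSq, stencil]

theorem gradNormSq_eq_sum_halfSq {N : ℕ} [NeZero N] (h : ℝ) (u : GF N) :
    gradNormSq h u = h ^ 2 * ∑ p, halfSq (stencil h u p) := by
  have hx : ∑ p : ZMod N × ZMod N, Dx h u (p.1 - 1, p.2) ^ 2 = ∑ p, Dx h u p ^ 2 :=
    ((Equiv.subRight 1).prodCongr (Equiv.refl _)).sum_comp fun p => Dx h u p ^ 2
  have hy : ∑ p : ZMod N × ZMod N, Dy h u (p.1, p.2 - 1) ^ 2 = ∑ p, Dy h u p ^ 2 :=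
    ((Equiv.refl _).prodCongr (Equiv.subRight 1)).sum_comp fun p => Dy h u p ^ 2
  simp only [gradNormSq, halfSq, stencil, Matrix.cons_val, ← Finset.mul_sum,
    Finset.sum_add_distrib, hx, hy]
  ring

theorem convexOn_finset_sum {E ι : Type*} [AddCommGroup E] [Module ℝ E] {S : Set E}
    (hS : Convex ℝ S) (t : Finset ι) {f : ι → E → ℝ} (hf : ∀ i ∈ t, ConvexOn ℝ S (f i)) :
    ConvexOn ℝ S fun z => ∑ i ∈ t, f i z := by
  refine ⟨hS, fun z hz w hw a b ha hb hab => ?_⟩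
  simp only [Finset.smul_sum, ← Finset.sum_add_distrib]
  exact Finset.sum_le_sum fun i hi => (hf i hi).2 hz hw ha hb hab

theorem convexOn_gradNormSq {N : ℕ} [NeZero N] (h : ℝ) :
    ConvexOn ℝ Set.univ fun u : GF N => gradNormSq h u :=
  (convexOn_finset_sum convex_univ _ fun p _ =>
    (convexOn_sq_of_isLinearMap convex_univ (isLinearMap_Dx h p)).add
      (convexOn_sq_of_isLinearMap convex_univ (isLinearMap_Dy h p))).smul (sq_nonneg h)

theorem convexOn_sub_const_pow {n : ℕ} (hn : Even n) (c : ℝ) :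
    ConvexOn ℝ Set.univ fun x : ℝ => (x - c) ^ n := by
  simpa [Function.comp_def, sub_eq_add_neg] using
    (hn.convexOn_pow (𝕜 := ℝ)).translate_left (-c)

theorem energyEc_eq {N : ℕ} [NeZero N] (h ε η ξ α β δ : ℝ) (φ ρ : GF N) :
    energyEc h ε η ξ α β δ φ ρ = h ^ 2 * ∑ p : ZMod N × ZMod N,
      ((1 / (4 * ε)) * (φ p - 1 / 2) ^ 4 + 1 / (64 * ε) + (η ^ 2 / 2) * (lap h φ p) ^ 2
        + β * FH (ρ p) + (α / 2) * (((ρ p - √(halfSq (stencil h φ p) + δ ^ 2)) ^ 2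
          + halfSq (stencil h φ p) / δ) + (√2 - 1) * (ρ p) ^ 2))
      + (ε / 2) * gradNormSq h φ + (ξ / 2) * gradNormSq h ρ := by
  have hgrad : α / (2 * δ) * gradNormSq h φ
      = h ^ 2 * ∑ p, (α / 2) * (halfSq (stencil h φ p) / δ) := by
    rw [gradNormSq_eq_sum_halfSq, ← Finset.mul_sum, ← Finset.sum_div]
    simp only [div_eq_mul_inv, mul_inv]
    ring
  rw [energyEc, add_mul (ε / 2), hgrad]
  simp only [aGrad_eq_sqrt_halfSq, mul_add (α / 2), Finset.sum_add_distrib]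
  ring

theorem energyEc_sub_energyEe {N : ℕ} [NeZero N] (h ε η ξ α β δ : ℝ) (φ ρ : GF N) :
    energyEc h ε η ξ α β δ φ ρ - energyEe h ε α δ φ ρ = energyE h ε η ξ α β δ φ ρ := by
  have hsum : ∑ p : ZMod N × ZMod N,
      ((1 / (4 * ε)) * (φ p) ^ 2 * (1 - φ p) ^ 2 + (η ^ 2 / 2) * (lap h φ p) ^ 2
        + (α / 2) * (ρ p - aGrad h δ φ p) ^ 2 + β * FH (ρ p))
      = ∑ p : ZMod N × ZMod N, ((1 / (4 * ε)) * (φ p - 1 / 2) ^ 4 + 1 / (64 * ε)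
        + (η ^ 2 / 2) * (lap h φ p) ^ 2 + β * FH (ρ p)
        + (α / 2) * ((ρ p - aGrad h δ φ p) ^ 2 + (√2 - 1) * (ρ p) ^ 2))
      - ∑ p : ZMod N × ZMod N,
        ((1 / (8 * ε)) * (φ p - 1 / 2) ^ 2 + (α / 2) * (√2 - 1) * (ρ p) ^ 2) := by
    rw [← Finset.sum_sub_distrib]
    refine Finset.sum_congr rfl fun p _ => ?_
    simp only [one_div, mul_inv]
    ring
  rw [energyE, energyEc, energyEe, hsum]
  ring

theorem convex_setOf_density_mem_Ioo (N : ℕ) :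
    Convex ℝ {z : GF N × GF N | ∀ p, 0 < z.2 p ∧ z.2 p < 1} := by
  intro z hz w hw a b ha hb hab p
  exact convex_Ioo (0 : ℝ) 1 (hz p) (hw p) ha hb hab

/-- the fully discrete convex–concave decomposition:
(i) `E_c` is convex on the set of pairs of grid functions with `0 < ρ < 1` pointwise;
(ii) `E_e` is convex; (iii) `E_c − E_e = E` on that set. -/
theorem discrete_energy_convex_concave_decomposition
    (L : ℝ) (hL : 0 < L) (N : ℕ) [NeZero N] (h : ℝ) (hh : h = L / N)
    (ε η ξ α β δ : ℝ) (hε : 0 < ε) (hη : 0 < η) (hξ : 0 < ξ)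
    (hα : 0 < α) (hβ : 0 < β) (hδ : 0 < δ) :
    ConvexOn ℝ {z : GF N × GF N | ∀ p, 0 < z.2 p ∧ z.2 p < 1}
      (fun z : GF N × GF N => energyEc h ε η ξ α β δ z.1 z.2)
    ∧ ConvexOn ℝ (Set.univ : Set (GF N × GF N))
      (fun z : GF N × GF N => energyEe h ε α δ z.1 z.2)
    ∧ ∀ φ ρ : GF N, (∀ p, 0 < ρ p ∧ ρ p < 1) →
        energyEc h ε η ξ α β δ φ ρ - energyEe h ε α δ φ ρ
          = energyE h ε η ξ α β δ φ ρ := by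
  have hS := convex_setOf_density_mem_Ioo N
  have hφ : ∀ p, IsLinearMap ℝ fun z : GF N × GF N => z.1 p := fun p => by
    constructor <;> intros <;> simp
  have hρ : ∀ p, IsLinearMap ℝ fun z : GF N × GF N => z.2 p := fun p => by
    constructor <;> intros <;> simp
  have hsqrt : 0 ≤ √2 - 1 := sub_nonneg.2 (Real.one_le_sqrt.2 one_le_two)
  have hpow : ∀ p {n : ℕ}, Even n →
      ConvexOn ℝ Set.univ fun z : GF N × GF N => (z.1 p - 1 / 2) ^ n := fun p _ hn =>
    (convexOn_sub_const_pow hn (1 / 2)).comp_linearMap ((hφ p).mk' _)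
  have hgradφ : ConvexOn ℝ Set.univ fun z : GF N × GF N => gradNormSq h z.1 :=
    (convexOn_gradNormSq h).comp_linearMap (LinearMap.fst ℝ (GF N) (GF N))
  have hgradρ : ConvexOn ℝ Set.univ fun z : GF N × GF N => gradNormSq h z.2 :=
    (convexOn_gradNormSq h).comp_linearMap (LinearMap.snd ℝ (GF N) (GF N))
  refine ⟨?_, ?_, fun φ ρ _ => energyEc_sub_energyEe h ε η ξ α β δ φ ρ⟩
  · simp only [energyEc_eq]
    refine (((convexOn_finset_sum hS _ fun p _ => ?_).smul (sq_nonneg h)).add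
      ((hgradφ.subset (Set.subset_univ _) hS).smul (by positivity))).add
      ((hgradρ.subset (Set.subset_univ _) hS).smul (by positivity))
    have hquartic := (hpow p (n := 4) (by decide)).subset (Set.subset_univ _) hS
    have hlap : ConvexOn ℝ {z : GF N × GF N | ∀ p, 0 < z.2 p ∧ z.2 p < 1}
        fun z => lap h z.1 p ^ 2 :=
      convexOn_sq_of_isLinearMap hS
        (((isLinearMap_lap h p).mk' _).comp (LinearMap.fst ℝ (GF N) (GF N))).isLinear
    have hFH : ConvexOn ℝ {z : GF N × GF N | ∀ p, 0 < z.2 p ∧ z.2 p < 1}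
        fun z => FH (z.2 p) :=
      (convexOn_FH.comp_linearMap ((hρ p).mk' _)).subset
        (fun z hz => ⟨(hz p).1.le, (hz p).2.le⟩) hS
    have hcoupling := convexOn_coupling hS hδ
      (((isLinearMap_stencil h p).mk' _).comp (LinearMap.fst ℝ (GF N) (GF N))).isLinear
      (hρ p) fun z hz => ⟨(hz p).1.le, (hz p).2.le⟩
    have hρsq := convexOn_sq_of_isLinearMap hS (hρ p)
    exact ((((hquartic.smul (by positivity)).add (convexOn_const _ hS)).add
      (hlap.smul (by positivity))).add (hFH.smul hβ.le)).add
      ((hcoupling.add (hρsq.smul hsqrt)).smul (by positivity))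
  · refine ((convexOn_finset_sum convex_univ _ fun p _ => ?_).smul (sq_nonneg h)).add
      (hgradφ.smul (by positivity))
    exact ((hpow p even_two).smul (by positivity)).add
      ((convexOn_sq_of_isLinearMap convex_univ (hρ p)).smul (mul_nonneg (by positivity) hsqrt))
end
end

section
/- Fix L > 0, a positive integer N, h = L/N, and parameters ε, η, ξ, α, β, δ, 𝓜, Δt > 0. Let φⁿ, ρⁿ be grid functions with 0 < (1/N²)·Σ_{i,j} ρⁿ_{i,j} < 1. Then there exists a unique pair of grid functions (φⁿ⁺¹, ρⁿ⁺¹) with 0 < ρⁿ⁺¹_{i,j} < 1 for all i,j satisfying the convex splitting scheme: (φⁿ⁺¹ − φⁿ)/Δt = 𝓜·Δ_h μ_φ and (ρⁿ⁺¹ − ρⁿ)/Δt = 𝓜·Δ_h μ_ρ, where μ_φ = (1/ε)(φⁿ⁺¹ − 1/2)³ − (ε + α + α/δ)·Δ_h φⁿ⁺¹ + η²·Δ_h(Δ_h φⁿ⁺¹) + α·𝒟(ρⁿ⁺¹, φⁿ⁺¹) − (1/(4ε))(φⁿ − 1/2) + (α/δ)·Δ_h φⁿ, and μ_ρ = −ξ·Δ_h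 ρⁿ⁺¹ + β·(ln ρⁿ⁺¹ − ln(1 − ρⁿ⁺¹)) + √2·α·ρⁿ⁺¹ − α·𝒜|∇_h^δ φⁿ⁺¹| − α(√2 − 1)·ρⁿ (all operations pointwise). -/
open scoped BigOperators

noncomputable section

/-- The edge coefficient `g_{i,j} = ρ_{i,j} / 𝒜|∇_h^δ φ|_{i,j}`. -/
def gfun {N : ℕ} (h δ : ℝ) (ρ φ : GF N) : GF N := fun p => ρ p / aGrad h δ φ p

/-- The averaged-coefficient discrete divergence
`𝒟(ρ,φ) = ∇_h · (𝒜(ρ/𝒜|∇_h^δ φ|) ∇_h φ)` with `g = ρ/𝒜|∇_h^δ φ|`. -/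
def divD {N : ℕ} (h δ : ℝ) (ρ φ : GF N) : GF N := fun p =>
  (1 / h) * ((1 / 2) * (gfun h δ ρ φ p + gfun h δ ρ φ (p.1 + 1, p.2)) * Dx h φ p
    - (1 / 2) * (gfun h δ ρ φ (p.1 - 1, p.2) + gfun h δ ρ φ p) * Dx h φ (p.1 - 1, p.2)
    + (1 / 2) * (gfun h δ ρ φ p + gfun h δ ρ φ (p.1, p.2 + 1)) * Dy h φ p
    - (1 / 2) * (gfun h δ ρ φ (p.1, p.2 - 1) + gfun h δ ρ φ p) * Dy h φ (p.1, p.2 - 1))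

/-- The discrete chemical potential `μ_φ` of the convex splitting scheme. -/
def muPhi {N : ℕ} (h ε η α δ : ℝ) (φn φ ρ : GF N) : GF N := fun p =>
  (1 / ε) * (φ p - 1 / 2) ^ 3 - (ε + α + α / δ) * lap h φ p
    + η ^ 2 * lap h (lap h φ) p + α * divD h δ ρ φ p
    - (1 / (4 * ε)) * (φn p - 1 / 2) + (α / δ) * lap h φn p

/-- The discrete chemical potential `μ_ρ` of the convex splitting scheme. -/
def muRho {N : ℕ} (h ξ α β δ : ℝ) (ρn φ ρ : GF N) : GF N := fun p =>
  -ξ * lap h ρ p + β * (Real.log (ρ p) - Real.log (1 - ρ p))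
    + Real.sqrt 2 * α * ρ p - α * aGrad h δ φ p - α * (Real.sqrt 2 - 1) * ρn p

section GridCalculus

variable {N : ℕ}

/-- The regularized gradient pairing: half the sum of the products of the four differences
adjacent to a node. -/
def gradPair (h : ℝ) (u v : GF N) : GF N := fun p =>
  (1 / 2) * (Dx h u p * Dx h v p + Dx h u (p.1 - 1, p.2) * Dx h v (p.1 - 1, p.2)
    + Dy h u p * Dy h v p + Dy h u (p.1, p.2 - 1) * Dy h v (p.1, p.2 - 1))

/-- Divergence of `w ∇u` with the coefficient `w` averaged to the edges. -/
def wdiv (h : ℝ) (w u : GF N) : GF N := fun p =>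
  (1 / h) * ((1 / 2) * (w p + w (p.1 + 1, p.2)) * Dx h u p
    - (1 / 2) * (w (p.1 - 1, p.2) + w p) * Dx h u (p.1 - 1, p.2)
    + (1 / 2) * (w p + w (p.1, p.2 + 1)) * Dy h u p
    - (1 / 2) * (w (p.1, p.2 - 1) + w p) * Dy h u (p.1, p.2 - 1))

theorem aGrad_eq (h δ : ℝ) (u : GF N) (p) :
    aGrad h δ u p = Real.sqrt (gradPair h u u p + δ ^ 2) := by
  simp only [aGrad, gradPair, sq]

theorem gradPair_comm (h : ℝ) (u v : GF N) : gradPair h u v = gradPair h v u := by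
  funext p; simp only [gradPair]; ring

theorem gradPair_self_nonneg (h : ℝ) (u : GF N) (p) : 0 ≤ gradPair h u u p := by
  simp only [gradPair, ← sq]; positivity

theorem gradPair_sub_left (h : ℝ) (u v w : GF N) (p) :
    gradPair h (u - v) w p = gradPair h u w p - gradPair h v w p := by
  simp only [gradPair, Dx, Dy, Pi.sub_apply]; ring

theorem gradPair_sub_right (h : ℝ) (u v w : GF N) (p) :
    gradPair h u (v - w) p = gradPair h u v p - gradPair h u w p := by
  rw [gradPair_comm, gradPair_sub_left, gradPair_comm h v, gradPair_comm h w]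

theorem gradPair_line (h : ℝ) (u v : GF N) (t : ℝ) (p) :
    gradPair h (u + t • v) (u + t • v) p
      = gradPair h u u p + t * (2 * gradPair h u v p) + t ^ 2 * gradPair h v v p := by
  simp only [gradPair, Dx, Dy, Pi.add_apply, Pi.smul_apply, smul_eq_mul]; ring

theorem gradPair_sq_le (h : ℝ) (u v : GF N) (p) :
    gradPair h u v p ^ 2 ≤ gradPair h u u p * gradPair h v v p := by
  simp only [gradPair]
  generalize Dx h u p = a, Dx h u (p.1 - 1, p.2) = b, Dy h u p = c, Dy h u (p.1, p.2 - 1) = d,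
    Dx h v p = a', Dx h v (p.1 - 1, p.2) = b', Dy h v p = c', Dy h v (p.1, p.2 - 1) = d'
  nlinarith [sq_nonneg (a * b' - b * a'), sq_nonneg (a * c' - c * a'), sq_nonneg (a * d' - d * a'),
    sq_nonneg (b * c' - c * b'), sq_nonneg (b * d' - d * b'), sq_nonneg (c * d' - d * c')]

theorem divD_eq_wdiv (h δ : ℝ) (ρ φ : GF N) : divD h δ ρ φ = wdiv h (gfun h δ ρ φ) φ := rfl

theorem wdiv_one (h : ℝ) (u : GF N) : wdiv h (fun _ => 1) u = lap h u := by
  funext p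
  simp only [wdiv, lap, Dx, Dy, sub_add_cancel]
  ring

/-- The discrete Laplacian as a linear map. -/
def lapLin (h : ℝ) : GF N →ₗ[ℝ] GF N where
  toFun := lap h
  map_add' u v := by funext p; simp only [lap, Pi.add_apply]; ring
  map_smul' t u := by
    funext p; simp only [lap, Pi.smul_apply, smul_eq_mul, RingHom.id_apply]; ring

theorem lap_add (h : ℝ) (u v : GF N) : lap h (u + v) = lap h u + lap h v :=
  map_add (lapLin h) u v

theorem lap_sub (h : ℝ) (u v : GF N) : lap h (u - v) = lap h u - lap h v :=
  map_sub (lapLin h) u v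

theorem lap_smul (h t : ℝ) (u : GF N) : lap h (t • u) = t • lap h u :=
  map_smul (lapLin h) t u

theorem sum_by_parts_perm {ι : Type*} [Fintype ι] (e : Equiv.Perm ι) (h : ℝ) (w a ψ : ι → ℝ) :
    ∑ p, w p * (1 / 2 * (a p * ((ψ (e p) - ψ p) / h)
        + a (e.symm p) * ((ψ p - ψ (e.symm p)) / h)))
      = -∑ p, ψ p * (1 / h * (1 / 2 * (w p + w (e p)) * a p
        - 1 / 2 * (w (e.symm p) + w p) * a (e.symm p))) := by
  have h1 := Equiv.sum_comp e.symm
    (fun p => 1 / 2 * (w (e p) * a p * ((ψ (e p) - ψ p) / h)))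
  have h2 := Equiv.sum_comp e.symm
    (fun p => 1 / h * (1 / 2 * (w p + w (e p)) * a p * ψ (e p)))
  simp only [Equiv.apply_symm_apply] at h1 h2
  rw [← sub_eq_zero, sub_neg_eq_add, ← Finset.sum_add_distrib]
  rw [← sub_eq_zero, ← Finset.sum_sub_distrib] at h1 h2
  rw [← add_zero (0 : ℝ)]
  nth_rewrite 2 [← h1]
  rw [← neg_zero, ← h2, ← Finset.sum_neg_distrib, ← Finset.sum_add_distrib]
  refine Finset.sum_congr rfl fun p _ => ?_
  ring

variable [NeZero N]

theorem sum_mul_gradPair (h : ℝ) (w u v : GF N) :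
    ∑ p, w p * gradPair h u v p = -∑ p, v p * wdiv h w u p := by
  have hx := sum_by_parts_perm
    (Equiv.prodCongr (Equiv.addRight (1 : ZMod N)) (Equiv.refl (ZMod N))) h w (Dx h u) v
  have hy := sum_by_parts_perm
    (Equiv.prodCongr (Equiv.refl (ZMod N)) (Equiv.addRight (1 : ZMod N))) h w (Dy h u) v
  simp only [Equiv.prodCongr_apply, Equiv.prodCongr_symm, Equiv.refl_symm, Equiv.addRight_symm,
    Equiv.coe_addRight, Equiv.coe_refl, Prod.map, id, ← sub_eq_add_neg] at hx hy
  have e1 : ∑ p, w p * gradPair h u v p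
      = ∑ p : ZMod N × ZMod N, w p * (1 / 2 * (Dx h u p * ((v (p.1 + 1, p.2) - v p) / h)
        + Dx h u (p.1 - 1, p.2) * ((v p - v (p.1 - 1, p.2)) / h)))
      + ∑ p : ZMod N × ZMod N, w p * (1 / 2 * (Dy h u p * ((v (p.1, p.2 + 1) - v p) / h)
        + Dy h u (p.1, p.2 - 1) * ((v p - v (p.1, p.2 - 1)) / h))) := by
    rw [← Finset.sum_add_distrib]
    refine Finset.sum_congr rfl fun p _ => ?_
    simp only [gradPair, Dx, Dy, sub_add_cancel]
    ring
  rw [e1, hx, hy, ← neg_add, ← Finset.sum_add_distrib]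
  congr 1
  refine Finset.sum_congr rfl fun p _ => ?_
  simp only [wdiv]
  ring

theorem sum_gradPair (h : ℝ) (u v : GF N) :
    ∑ p, gradPair h u v p = -∑ p, v p * lap h u p := by
  simpa [wdiv_one] using sum_mul_gradPair h (fun _ => 1) u v

theorem sum_mul_lap_comm (h : ℝ) (u v : GF N) :
    ∑ p, u p * lap h v p = ∑ p, v p * lap h u p := by
  have h1 := sum_gradPair h u v
  have h2 := sum_gradPair h v u
  rw [gradPair_comm] at h2
  linarith

theorem sum_mul_lap_self_nonpos (h : ℝ) (u : GF N) : ∑ p, u p * lap h u p ≤ 0 := by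
  have h1 := sum_gradPair h u u
  have h2 := Finset.sum_nonneg fun p (_ : p ∈ Finset.univ) => gradPair_self_nonneg h u p
  linarith

theorem eq_of_succ_eq {f : ZMod N → ℝ} (hf : ∀ i, f (i + 1) = f i) (i : ZMod N) : f i = f 0 := by
  have key : ∀ n : ℕ, f (n : ZMod N) = f 0 := by
    intro n
    induction n with
    | zero => simp
    | succ k ih => rw [Nat.cast_succ, hf, ih]
  simpa using key i.val

theorem eq_const_of_lap_eq_zero {h : ℝ} (hh : h ≠ 0) {u : GF N} (hu : lap h u = 0) (p) :
    u p = u (0, 0) := by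
  have h0 : ∑ p, gradPair h u u p = 0 := by rw [sum_gradPair, hu]; simp
  rw [Finset.sum_eq_zero_iff_of_nonneg fun p _ => gradPair_self_nonneg h u p] at h0
  have hD : ∀ p, Dx h u p = 0 ∧ Dy h u p = 0 := by
    intro p
    have := h0 p (Finset.mem_univ p)
    simp only [gradPair] at this
    constructor <;>
    nlinarith [sq_nonneg (Dx h u p), sq_nonneg (Dx h u (p.1 - 1, p.2)), sq_nonneg (Dy h u p),
      sq_nonneg (Dy h u (p.1, p.2 - 1))]
  have hx : ∀ i j, u (i + 1, j) = u (i, j) := fun i j => by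
    have := (hD (i, j)).1
    simp only [Dx, div_eq_zero_iff, hh, or_false] at this
    linarith
  have hy : ∀ i j, u (i, j + 1) = u (i, j) := fun i j => by
    have := (hD (i, j)).2
    simp only [Dy, div_eq_zero_iff, hh, or_false] at this
    linarith
  obtain ⟨i, j⟩ := p
  rw [eq_of_succ_eq (f := fun i => u (i, j)) (fun i => hx i j) i,
    eq_of_succ_eq (f := fun j => u (0, j)) (fun j => hy 0 j) j]

theorem mem_range_lapLin {h : ℝ} (hh : h ≠ 0) {f : GF N} (hf : ∑ p, f p = 0) :
    f ∈ LinearMap.range (lapLin (N := N) h) := by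
  by_contra hmem
  obtain ⟨l, hl, hle⟩ := Submodule.exists_le_ker_of_notMem hmem
  set X : GF N := fun p => l (Pi.single p 1) with hX
  have hlX : ∀ v : GF N, l v = ∑ p, v p * X p := by
    intro v
    conv_lhs => rw [← Finset.univ_sum_single v]
    rw [map_sum]
    refine Finset.sum_congr rfl fun p _ => ?_
    rw [hX, ← smul_eq_mul, ← map_smul, ← Pi.single_smul, smul_eq_mul, mul_one]
  have hlap : lap h X = 0 := by
    have h1 : l (lap h (lap h X)) = 0 := hle ⟨lap h X, rfl⟩
    rw [hlX] at h1
    simp_rw [mul_comm _ (X _)] at h1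
    rw [sum_mul_lap_comm, Finset.sum_eq_zero_iff_of_nonneg fun p _ => mul_self_nonneg _] at h1
    funext p
    exact mul_self_eq_zero.1 (h1 p (Finset.mem_univ p))
  apply hl
  rw [hlX]
  simp_rw [eq_const_of_lap_eq_zero hh hlap, ← Finset.sum_mul, hf, zero_mul]

theorem sum_mul_muPhi (h ε η α δ : ℝ) (φn φ ρ ψ : GF N) :
    ∑ p, ψ p * muPhi h ε η α δ φn φ ρ p
      = ∑ p, ((1 / ε) * (φ p - 1 / 2) ^ 3 * ψ p + (ε + α + α / δ) * gradPair h φ ψ p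
        + η ^ 2 * (lap h φ p * lap h ψ p) - α * (gfun h δ ρ φ p * gradPair h φ ψ p)
        + (-(1 / (4 * ε)) * (φn p - 1 / 2) + (α / δ) * lap h φn p) * ψ p) := by
  have h1 := sum_gradPair h φ ψ
  have h2 := sum_mul_lap_comm h ψ (lap h φ)
  have h3 := sum_mul_gradPair h (gfun h δ ρ φ) φ ψ
  rw [← divD_eq_wdiv] at h3
  simp only [Finset.sum_add_distrib, Finset.sum_sub_distrib, ← Finset.mul_sum, h1, ← h2, h3]
  simp only [mul_neg, Finset.mul_sum, ← Finset.sum_neg_distrib, ← Finset.sum_add_distrib,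
    ← Finset.sum_sub_distrib]
  refine Finset.sum_congr rfl fun p _ => ?_
  simp only [muPhi]
  ring

theorem sum_mul_muRho (h ξ α β δ : ℝ) (ρn φ ρ σ : GF N) :
    ∑ p, σ p * muRho h ξ α β δ ρn φ ρ p
      = ∑ p, (ξ * gradPair h ρ σ p + β * (Real.log (ρ p) - Real.log (1 - ρ p)) * σ p
        + Real.sqrt 2 * α * ρ p * σ p - α * aGrad h δ φ p * σ p
        - α * (Real.sqrt 2 - 1) * ρn p * σ p) := by
  have h1 := sum_gradPair h ρ σ
  simp only [Finset.sum_add_distrib, Finset.sum_sub_distrib, ← Finset.mul_sum, h1]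
  simp only [mul_neg, Finset.mul_sum, ← Finset.sum_neg_distrib,
    ← Finset.sum_add_distrib, ← Finset.sum_sub_distrib]
  refine Finset.sum_congr rfl fun p _ => ?_
  simp only [muRho]
  ring

end GridCalculus

section Monotonicity

theorem coupling_monotone_scalar {s t c δ A B r₁ r₂ : ℝ} (hs : 0 ≤ s) (ht : 0 ≤ t)
    (hc : c ^ 2 ≤ s * t) (hδ : 0 < δ) (hA : A = Real.sqrt (s + δ ^ 2))
    (hB : B = Real.sqrt (t + δ ^ 2)) (h0 : 0 ≤ r₂) (h1 : r₂ ≤ 1) :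
    r₁ / A * (s - c) - r₂ / B * (c - t) + (r₁ - r₂) * (A - B)
      ≤ (1 + 1 / δ) * (s + t - 2 * c) + Real.sqrt 2 * (r₁ - r₂) ^ 2 := by
  have hA2 : A ^ 2 = s + δ ^ 2 := by rw [hA, Real.sq_sqrt (by positivity)]
  have hB2 : B ^ 2 = t + δ ^ 2 := by rw [hB, Real.sq_sqrt (by positivity)]
  have hAδ : δ ≤ A := by rw [hA]; exact Real.le_sqrt_of_sq_le (by linarith)
  have hBδ : δ ≤ B := by rw [hB]; exact Real.le_sqrt_of_sq_le (by linarith)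
  have hA0 : 0 < A := hδ.trans_le hAδ
  have hB0 : 0 < B := hδ.trans_le hBδ
  have hd : 0 ≤ s + t - 2 * c := by nlinarith [sq_nonneg (s - t), sq_nonneg (s + t)]
  have hcs : c + δ ^ 2 ≤ A * B := by
    refine le_of_sq_le_sq ?_ (by positivity)
    rw [mul_pow, hA2, hB2]
    nlinarith [mul_nonneg (sq_nonneg δ) hd]
  have hAB : (A - B) ^ 2 ≤ s + t - 2 * c := by nlinarith
  have hsc : ((s - c) / A) ^ 2 ≤ s + t - 2 * c := by
    rw [div_pow, div_le_iff₀ (by positivity), hA2]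
    nlinarith [mul_nonneg (sq_nonneg δ) hd]
  have hlip : (s - c) / A - (c - t) / B ≤ (s + t - 2 * c) / δ := by
    rcases le_total A B with hle | hle
    · have e : (s - c) / A - (c - t) / B
          = (s + t - 2 * c) / A + (c - t) * (1 / A - 1 / B) := by field_simp; ring
      have e1 : (s + t - 2 * c) / A ≤ (s + t - 2 * c) / δ := by gcongr
      have e2 : 0 ≤ 1 / A - 1 / B := sub_nonneg.2 (one_div_le_one_div_of_le hA0 hle)
      have e3 : c - t ≤ 0 := by nlinarith
      nlinarith [mul_nonneg e2 (neg_nonneg.2 e3)]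
    · have e : (s - c) / A - (c - t) / B
          = (s + t - 2 * c) / B - (s - c) * (1 / B - 1 / A) := by field_simp; ring
      have e1 : (s + t - 2 * c) / B ≤ (s + t - 2 * c) / δ := by gcongr
      have e2 : 0 ≤ 1 / B - 1 / A := sub_nonneg.2 (one_div_le_one_div_of_le hB0 hle)
      have e3 : 0 ≤ s - c := by nlinarith
      nlinarith [mul_nonneg e2 e3]
  have hdδ : 0 ≤ (s + t - 2 * c) / δ := by positivity
  have h2 : 1 ≤ Real.sqrt 2 := Real.one_le_sqrt.2 one_le_two
  have e : r₁ / A * (s - c) - r₂ / B * (c - t)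
      = (r₁ - r₂) * ((s - c) / A) + r₂ * ((s - c) / A - (c - t) / B) := by ring
  have e1 : r₂ * ((s - c) / A - (c - t) / B) ≤ (s + t - 2 * c) / δ :=
    (mul_le_mul_of_nonneg_left hlip h0).trans (mul_le_of_le_one_left hdδ h1)
  rw [e]
  have e2 : (1 + 1 / δ) * (s + t - 2 * c) = (s + t - 2 * c) + (s + t - 2 * c) / δ := by ring
  rw [e2]
  nlinarith [sq_nonneg (r₁ - r₂ - (s - c) / A), sq_nonneg (r₁ - r₂ - (A - B)),
    mul_nonneg (sub_nonneg.2 h2) (sq_nonneg (r₁ - r₂))]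

theorem coupling_monotone {N : ℕ} (h : ℝ) {δ : ℝ} (hδ : 0 < δ) (φ₁ φ₂ ρ₁ ρ₂ : GF N) (p)
    (h0 : 0 ≤ ρ₂ p) (h1 : ρ₂ p ≤ 1) :
    gfun h δ ρ₁ φ₁ p * gradPair h φ₁ (φ₁ - φ₂) p - gfun h δ ρ₂ φ₂ p * gradPair h φ₂ (φ₁ - φ₂) p
        + (ρ₁ p - ρ₂ p) * (aGrad h δ φ₁ p - aGrad h δ φ₂ p)
      ≤ (1 + 1 / δ) * gradPair h (φ₁ - φ₂) (φ₁ - φ₂) p + Real.sqrt 2 * (ρ₁ p - ρ₂ p) ^ 2 := by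
  have := coupling_monotone_scalar (r₁ := ρ₁ p) (gradPair_self_nonneg h φ₁ p)
    (gradPair_self_nonneg h φ₂ p)
    (gradPair_sq_le h φ₁ φ₂ p) hδ (aGrad_eq h δ φ₁ p) (aGrad_eq h δ φ₂ p) h0 h1
  simp only [gradPair_sub_left, gradPair_sub_right, gradPair_comm h φ₂ φ₁, gfun] at this ⊢
  linarith

theorem sub_mul_cube_sub_cube_nonneg (x y : ℝ) : 0 ≤ (x - y) * (x ^ 3 - y ^ 3) := by
  have : (x - y) * (x ^ 3 - y ^ 3) = (x - y) ^ 2 * ((x + y) ^ 2 + x ^ 2 + y ^ 2) / 2 := by ring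
  rw [this]; positivity

theorem eq_of_sub_mul_cube_sub_cube_eq_zero {x y : ℝ} (h : (x - y) * (x ^ 3 - y ^ 3) = 0) :
    x = y := by
  rcases mul_eq_zero.1 h with h | h
  · linarith
  · exact (Odd.strictMono_pow (by decide : Odd 3)).injective (sub_eq_zero.1 h)

theorem logit_strictMonoOn :
    StrictMonoOn (fun x : ℝ => Real.log x - Real.log (1 - x)) (Set.Ioo 0 1) := by
  intro x hx y hy hxy
  have h1 := Real.log_lt_log hx.1 hxy
  have h2 : Real.log (1 - y) < Real.log (1 - x) :=
    Real.log_lt_log (by linarith [hy.2]) (by linarith)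
  simp only
  linarith

end Monotonicity

section Entropy

theorem FH_eq_neg_binEntropy (s : ℝ) : FH s = -Real.binEntropy s := by
  rw [Real.binEntropy_eq_negMulLog_add_negMulLog_one_sub]
  simp only [FH, Real.negMulLog]
  ring

theorem continuous_FH : Continuous FH := by
  rw [show FH = fun s => -Real.binEntropy s from funext FH_eq_neg_binEntropy]
  exact Real.binEntropy_continuous.neg

theorem neg_log_two_le_FH (s : ℝ) : -Real.log 2 ≤ FH s := by
  rw [FH_eq_neg_binEntropy]
  exact neg_le_neg Real.binEntropy_le_log_two

theorem hasDerivAt_FH {s : ℝ} (h0 : 0 < s) (h1 : s < 1) :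
    HasDerivAt FH (Real.log s - Real.log (1 - s)) s := by
  rw [show FH = fun s => -Real.binEntropy s from funext FH_eq_neg_binEntropy]
  exact (Real.hasDerivAt_binEntropy h0.ne' h1.ne).neg.congr_deriv (by ring)

theorem FH_segment_le {s m t : ℝ} (hs : s ∈ Set.Icc (0 : ℝ) 1) (hm : m ∈ Set.Icc (0 : ℝ) 1)
    (ht0 : 0 ≤ t) (ht1 : t ≤ 1) : FH (s + t * (m - s)) ≤ FH s + t * (FH m - FH s) := by
  have h := Real.strictConcave_binEntropy.concaveOn.2 hs hm (sub_nonneg.2 ht1) ht0 (by ring)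
  simp only [smul_eq_mul] at h
  rw [show (1 - t) * s + t * m = s + t * (m - s) by ring] at h
  simp only [FH_eq_neg_binEntropy]
  linarith

theorem FH_mul_le {m t : ℝ} (hm0 : 0 < m) (hm1 : m < 1) (ht0 : 0 < t) (ht1 : t ≤ 1) :
    FH (t * m) ≤ t * (m * Real.log t) := by
  have htm : t * m < 1 := by nlinarith
  have h1 : (1 - t * m) * Real.log (1 - t * m) ≤ 0 :=
    mul_nonpos_of_nonneg_of_nonpos (by linarith)
      (Real.log_nonpos (by linarith) (by nlinarith [mul_pos ht0 hm0]))
  have h2 : t * m * Real.log m ≤ 0 :=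
    mul_nonpos_of_nonneg_of_nonpos (by positivity) (Real.log_nonpos hm0.le hm1.le)
  simp only [FH]
  rw [Real.log_mul ht0.ne' hm0.ne']
  linarith

theorem FH_one_sub (s : ℝ) : FH (1 - s) = FH s := by
  simp only [FH, sub_sub_cancel]; ring

theorem FH_endpoint_segment_le {s m t : ℝ} (hs : s = 0 ∨ s = 1) (hm0 : 0 < m) (hm1 : m < 1)
    (ht0 : 0 < t) (ht1 : t ≤ 1) :
    FH (s + t * (m - s)) ≤ FH s + t * (min m (1 - m) * Real.log t) := by
  have hlog : Real.log t ≤ 0 := Real.log_nonpos ht0.le ht1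
  rcases hs with rfl | rfl
  · have h0 : FH 0 = 0 := by simp [FH]
    rw [h0, zero_add, zero_add, sub_zero]
    refine (FH_mul_le hm0 hm1 ht0 ht1).trans (mul_le_mul_of_nonneg_left ?_ ht0.le)
    exact mul_le_mul_of_nonpos_right (min_le_left _ _) hlog
  · have h1 : FH 1 = 0 := by simp [FH]
    rw [h1, zero_add, show 1 + t * (m - 1) = 1 - t * (1 - m) by ring, FH_one_sub]
    refine (FH_mul_le (by linarith) (by linarith) ht0 ht1).trans
      (mul_le_mul_of_nonneg_left ?_ ht0.le)
    exact mul_le_mul_of_nonpos_right (min_le_right _ _) hlog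

open Filter Topology in
/-- A point minimizing a differentiable perturbation of the entropy along the segment towards a
constant interior state is itself interior. -/
theorem interior_of_entropy_min {ι : Type*} [Fintype ι] {ρ : ι → ℝ}
    (hρ : ∀ p, ρ p ∈ Set.Icc (0 : ℝ) 1) {m : ℝ} (hm0 : 0 < m) (hm1 : m < 1) {S : ℝ → ℝ} {D β : ℝ}
    (hS : HasDerivAt S D 0) (hβ : 0 < β)
    (hmin : ∀ t ∈ Set.Ioc (0 : ℝ) 1,
      S 0 + β * ∑ p, FH (ρ p) ≤ S t + β * ∑ p, FH (ρ p + t * (m - ρ p))) (p₀ : ι) :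
    0 < ρ p₀ ∧ ρ p₀ < 1 := by
  classical
  by_contra hcon
  have hend : ρ p₀ = 0 ∨ ρ p₀ = 1 := by
    obtain ⟨h0, h1⟩ := hρ p₀
    rcases h0.eq_or_lt with h | h
    · exact Or.inl h.symm
    · exact Or.inr (h1.antisymm (not_lt.1 fun h' => hcon ⟨h, h'⟩))
  set C := ∑ p ∈ Finset.univ.erase p₀, (FH m - FH (ρ p)) with hC
  have hκ : 0 < min m (1 - m) := lt_min hm0 (sub_pos.2 hm1)
  have hslope : ∀ᶠ t in 𝓝[>] (0 : ℝ), t⁻¹ • (S (0 + t) - S 0) < D + 1 :=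
    ((hasDerivAt_iff_tendsto_slope_zero.1 hS).mono_left
      (nhdsWithin_mono _ fun t (ht : 0 < t) => ht.ne')).eventually_lt_const (by linarith)
  have hlog : ∀ᶠ t in 𝓝[>] (0 : ℝ),
      Real.log t < -((D + 1) / β + C) / min m (1 - m) :=
    Real.tendsto_log_nhdsGT_zero.eventually_lt_atBot _
  have hone : ∀ᶠ t in 𝓝[>] (0 : ℝ), t ∈ Set.Ioc (0 : ℝ) 1 := Ioc_mem_nhdsGT one_pos
  obtain ⟨t, h1, h2, ht⟩ := (hslope.and (hlog.and hone)).exists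
  have hSt : S t - S 0 < t * (D + 1) := by
    rwa [zero_add, smul_eq_mul, inv_mul_lt_iff₀ ht.1] at h1
  have hlt : min m (1 - m) * Real.log t < -((D + 1) / β + C) := by
    rwa [lt_div_iff₀ hκ, mul_comm] at h2
  have hsum : ∑ p, FH (ρ p + t * (m - ρ p))
      ≤ ∑ p, FH (ρ p) + t * (min m (1 - m) * Real.log t + C) := by
    rw [← Finset.add_sum_erase _ _ (Finset.mem_univ p₀),
      ← Finset.add_sum_erase _ (fun p => FH (ρ p)) (Finset.mem_univ p₀)]
    have e1 := FH_endpoint_segment_le hend hm0 hm1 ht.1 ht.2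
    have e2 : ∑ p ∈ Finset.univ.erase p₀, FH (ρ p + t * (m - ρ p))
        ≤ ∑ p ∈ Finset.univ.erase p₀, FH (ρ p) + t * C := by
      rw [hC, Finset.mul_sum, ← Finset.sum_add_distrib]
      exact Finset.sum_le_sum fun p _ => FH_segment_le (hρ p) ⟨hm0.le, hm1.le⟩ ht.1.le ht.2
    linarith
  have hfin : t * (min m (1 - m) * Real.log t + C) < t * (-((D + 1) / β)) :=
    mul_lt_mul_of_pos_left (by linarith) ht.1
  have hfin' : β * (t * (min m (1 - m) * Real.log t + C)) < -(t * (D + 1)) := by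
    have e : β * (t * (-((D + 1) / β))) = -(t * (D + 1)) := by field_simp
    rw [← e]
    exact mul_lt_mul_of_pos_left hfin hβ
  have := hmin t ht
  have := mul_le_mul_of_nonneg_left hsum hβ.le
  linarith

end Entropy

section Energy

variable {N : ℕ} [NeZero N]

/-- The discrete energy of one time step without its entropy part; `G` plays the role of the
inverse Laplacian. -/
def smoothEnergy (G : GF N →ₗ[ℝ] GF N) (h τ ε η ξ α δ : ℝ) (φn ρn φ ρ : GF N) : ℝ :=
  -(1 / (2 * τ)) * ∑ p, (φ - φn) p * G (φ - φn) p
    + -(1 / (2 * τ)) * ∑ p, (ρ - ρn) p * G (ρ - ρn) p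
    + ∑ p, ((1 / (4 * ε)) * (φ p - 1 / 2) ^ 4 + (ε + α + α / δ) / 2 * gradPair h φ φ p
      + η ^ 2 / 2 * (lap h φ p) ^ 2
      + (-(1 / (4 * ε)) * (φn p - 1 / 2) + (α / δ) * lap h φn p) * φ p
      + ξ / 2 * gradPair h ρ ρ p + Real.sqrt 2 * α / 2 * ρ p ^ 2 - α * (ρ p * aGrad h δ φ p)
      - α * (Real.sqrt 2 - 1) * ρn p * ρ p)

omit [NeZero N] in
theorem hasDerivAt_line (u v : GF N) (p) :
    HasDerivAt (fun t : ℝ => (u + t • v) p) (v p) 0 := by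
  simpa using ((hasDerivAt_id (0 : ℝ)).mul_const (v p)).const_add (u p)

omit [NeZero N] in
theorem hasDerivAt_lap_line (h : ℝ) (u v : GF N) (p) :
    HasDerivAt (fun t : ℝ => lap h (u + t • v) p) (lap h v p) 0 := by
  simpa only [lap_add, lap_smul] using hasDerivAt_line (lap h u) (lap h v) p

omit [NeZero N] in
theorem hasDerivAt_gradPair_line (h : ℝ) (u v : GF N) (p) :
    HasDerivAt (fun t : ℝ => gradPair h (u + t • v) (u + t • v) p) (2 * gradPair h u v p) 0 := by
  simp only [gradPair_line]
  exact ((((hasDerivAt_id (0 : ℝ)).mul_const (2 * gradPair h u v p)).const_add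
    (gradPair h u u p)).add
      (((hasDerivAt_id (0 : ℝ)).pow 2).mul_const (gradPair h v v p))).congr_deriv (by simp)

omit [NeZero N] in
theorem hasDerivAt_aGrad_line (h : ℝ) {δ : ℝ} (hδ : 0 < δ) (u v : GF N) (p) :
    HasDerivAt (fun t : ℝ => aGrad h δ (u + t • v) p) (gradPair h u v p / aGrad h δ u p) 0 := by
  simp only [aGrad_eq]
  have hne : gradPair h (u + (0 : ℝ) • v) (u + (0 : ℝ) • v) p + δ ^ 2 ≠ 0 := by
    have := gradPair_self_nonneg h (u + (0 : ℝ) • v) p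
    positivity
  refine (((hasDerivAt_gradPair_line h u v p).add_const (δ ^ 2)).sqrt hne).congr_deriv ?_
  rw [zero_smul, add_zero, mul_div_mul_left _ _ two_ne_zero]

theorem hasDerivAt_inverse_form_line {h : ℝ} {G : GF N →ₗ[ℝ] GF N}
    (hG : ∀ f ∈ LinearMap.range (lapLin (N := N) h), lap h (G f) = f) {f v : GF N}
    (hf : f ∈ LinearMap.range (lapLin (N := N) h)) :
    HasDerivAt (fun t : ℝ => ∑ p, (f + t • lap h v) p * G (f + t • lap h v) p)
      (2 * ∑ p, v p * f p) 0 := by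
  have e : ∀ p ∈ Finset.univ, HasDerivAt
      (fun t : ℝ => (f + t • lap h v) p * G (f + t • lap h v) p)
      (lap h v p * G f p + f p * G (lap h v) p) 0 := by
    intro p _
    simp only [map_add, map_smul]
    exact ((hasDerivAt_line f (lap h v) p).mul
      (hasDerivAt_line (G f) (G (lap h v)) p)).congr_deriv (by simp)
  refine (HasDerivAt.fun_sum e).congr_deriv ?_
  rw [Finset.sum_add_distrib]
  have h1 : ∑ p, lap h v p * G f p = ∑ p, v p * f p := by
    simp_rw [mul_comm (lap h v _)]
    rw [sum_mul_lap_comm, hG f hf]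
  have h2 : ∑ p, f p * G (lap h v) p = ∑ p, v p * f p := by
    rw [← h1]
    conv_lhs => rw [← hG f hf]
    simp_rw [mul_comm (lap h (G f) _)]
    rw [sum_mul_lap_comm, hG (lap h v) ⟨v, rfl⟩]
    exact Finset.sum_congr rfl fun p _ => mul_comm _ _
  rw [h1, h2]
  ring

theorem hasDerivAt_smoothEnergy_line {G : GF N →ₗ[ℝ] GF N} {h δ : ℝ}
    (hG : ∀ f ∈ LinearMap.range (lapLin (N := N) h), lap h (G f) = f) (τ ε η ξ α : ℝ)
    (hδ : 0 < δ) {φn ρn φ ρ : GF N} (v w : GF N)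
    (hφ : φ - φn ∈ LinearMap.range (lapLin (N := N) h))
    (hρ : ρ - ρn ∈ LinearMap.range (lapLin (N := N) h)) :
    HasDerivAt (fun t : ℝ => smoothEnergy G h τ ε η ξ α δ φn ρn
        (φ + t • lap h v) (ρ + t • lap h w))
      (-(1 / τ) * ∑ p, v p * (φ - φn) p + -(1 / τ) * ∑ p, w p * (ρ - ρn) p
        + (∑ p, lap h v p * muPhi h ε η α δ φn φ ρ p
          + ∑ p, lap h w p * muRho h ξ α 0 δ ρn φ ρ p)) 0 := by
  simp only [smoothEnergy, add_sub_right_comm _ _ φn, add_sub_right_comm _ _ ρn]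
  rw [sum_mul_muPhi, sum_mul_muRho, ← Finset.sum_add_distrib]
  refine HasDerivAt.add (HasDerivAt.add ?_ ?_) (HasDerivAt.fun_sum fun p _ => ?_)
  · exact ((hasDerivAt_inverse_form_line hG (v := v) hφ).const_mul
      (-(1 / (2 * τ)))).congr_deriv (by ring)
  · exact ((hasDerivAt_inverse_form_line hG (v := w) hρ).const_mul
      (-(1 / (2 * τ)))).congr_deriv (by ring)
  · have d1 := hasDerivAt_line φ (lap h v) p
    have d2 := hasDerivAt_line ρ (lap h w) p
    refine ((((((((((d1.sub_const (1 / 2)).pow 4).const_mul (1 / (4 * ε))).add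
      ((hasDerivAt_gradPair_line h φ (lap h v) p).const_mul ((ε + α + α / δ) / 2))).add
      (((hasDerivAt_lap_line h φ (lap h v) p).pow 2).const_mul (η ^ 2 / 2))).add
      (d1.const_mul (-(1 / (4 * ε)) * (φn p - 1 / 2) + (α / δ) * lap h φn p))).add
      ((hasDerivAt_gradPair_line h ρ (lap h w) p).const_mul (ξ / 2))).add
      ((d2.pow 2).const_mul (Real.sqrt 2 * α / 2))).sub
      ((d2.mul (hasDerivAt_aGrad_line h hδ φ (lap h v) p)).const_mul α)).sub
      (d2.const_mul (α * (Real.sqrt 2 - 1) * ρn p))).congr_deriv ?_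
    simp only [zero_smul, add_zero, gfun]
    push_cast
    ring

omit [NeZero N] in
theorem continuous_gradPair_self (h : ℝ) (p) : Continuous fun u : GF N => gradPair h u u p := by
  simp only [gradPair, Dx, Dy]
  fun_prop

theorem continuous_lap (h : ℝ) : Continuous (lap h : GF N → GF N) :=
  (lapLin h).continuous_of_finiteDimensional

omit [NeZero N] in
theorem continuous_aGrad (h δ : ℝ) (p) : Continuous fun u : GF N => aGrad h δ u p := by
  simp only [aGrad_eq]
  exact ((continuous_gradPair_self h p).add continuous_const).sqrt

theorem continuous_smoothEnergy (G : GF N →ₗ[ℝ] GF N) (h τ ε η ξ α δ : ℝ) (φn ρn : GF N) :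
    Continuous fun z : GF N × GF N => smoothEnergy G h τ ε η ξ α δ φn ρn z.1 z.2 := by
  have hGc : Continuous G := G.continuous_of_finiteDimensional
  have h1 : ∀ p, Continuous fun z : GF N × GF N => gradPair h z.1 z.1 p :=
    fun p => (continuous_gradPair_self h p).comp continuous_fst
  have h2 : ∀ p, Continuous fun z : GF N × GF N => gradPair h z.2 z.2 p :=
    fun p => (continuous_gradPair_self h p).comp continuous_snd
  have h3 : ∀ p, Continuous fun z : GF N × GF N => aGrad h δ z.1 p :=
    fun p => (continuous_aGrad h δ p).comp continuous_fst
  have h4 : Continuous (lap h : GF N → GF N) := continuous_lap h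
  simp only [smoothEnergy, Pi.sub_apply]
  fun_prop

theorem smoothEnergy_coercive {G : GF N →ₗ[ℝ] GF N} {h τ ε ξ α δ : ℝ} (η : ℝ)
    (hG : ∀ f ∈ LinearMap.range (lapLin (N := N) h), lap h (G f) = f) (hτ : 0 < τ) (hε : 0 < ε)
    (hξ : 0 < ξ) (hα : 0 < α) (hδ : 0 < δ) (φn ρn : GF N) :
    ∃ C : ℝ, ∀ φ ρ : GF N, φ - φn ∈ LinearMap.range (lapLin (N := N) h) →
      ρ - ρn ∈ LinearMap.range (lapLin (N := N) h) → (∀ p, ρ p ∈ Set.Icc (0 : ℝ) 1) →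
      ∑ p, (φ p - 1 / 2) ^ 2 - C ≤ smoothEnergy G h τ ε η ξ α δ φn ρn φ ρ := by
  set k : GF N := fun p => -(1 / (4 * ε)) * (φn p - 1 / 2) + (α / δ) * lap h φn p with hk
  refine ⟨∑ p, (4 * ε + k p ^ 2 / 4 - k p / 2 + α / 2 * (δ ^ 2 + 1)
    + α * (Real.sqrt 2 - 1) * |ρn p|), fun φ ρ hφ hρ hρ01 => ?_⟩
  have hQ : ∀ f ∈ LinearMap.range (lapLin (N := N) h),
      0 ≤ -(1 / (2 * τ)) * ∑ p, f p * G f p := by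
    intro f hf
    have := sum_mul_lap_self_nonpos h (G f)
    rw [hG f hf] at this
    simp_rw [mul_comm (f _)]
    exact mul_nonneg_of_nonpos_of_nonpos (neg_nonpos.2 (by positivity)) this
  have h1 := hQ _ hφ
  have h2 := hQ _ hρ
  refine le_trans ?_ (le_add_of_nonneg_left (add_nonneg h1 h2))
  rw [← Finset.sum_sub_distrib]
  refine Finset.sum_le_sum fun p _ => ?_
  obtain ⟨hr0, hr1⟩ := hρ01 p
  have hgφ := gradPair_self_nonneg h φ p
  have hgρ := gradPair_self_nonneg h ρ p
  have hA : aGrad h δ φ p ^ 2 = gradPair h φ φ p + δ ^ 2 := by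
    rw [aGrad_eq, Real.sq_sqrt (by positivity)]
  have hA0 : 0 ≤ aGrad h δ φ p := Real.sqrt_nonneg _
  have hs2 : 1 ≤ Real.sqrt 2 := Real.one_le_sqrt.2 one_le_two
  have e1 : 2 * (φ p - 1 / 2) ^ 2 - 4 * ε ≤ 1 / (4 * ε) * (φ p - 1 / 2) ^ 4 := by
    rw [one_div_mul_eq_div, le_div_iff₀ (by positivity)]
    nlinarith [sq_nonneg ((φ p - 1 / 2) ^ 2 - 4 * ε)]
  have e2 : -(φ p - 1 / 2) ^ 2 - k p ^ 2 / 4 + k p / 2 ≤ k p * φ p := by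
    nlinarith [sq_nonneg (φ p - 1 / 2 + k p / 2)]
  have e3 : α * (ρ p * aGrad h δ φ p) ≤ α / 2 * (gradPair h φ φ p + δ ^ 2 + 1) := by
    have : ρ p * aGrad h δ φ p ≤ aGrad h δ φ p := mul_le_of_le_one_left hA0 hr1
    nlinarith [sq_nonneg (aGrad h δ φ p - 1)]
  have e4 : α / 2 * gradPair h φ φ p ≤ (ε + α + α / δ) / 2 * gradPair h φ φ p := by
    have : 0 < α / δ := by positivity
    gcongr
    linarith
  have e5 : α * (Real.sqrt 2 - 1) * ρn p * ρ p ≤ α * (Real.sqrt 2 - 1) * |ρn p| := by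
    have h3 : ρn p * ρ p ≤ |ρn p| :=
      (mul_le_mul_of_nonneg_right (le_abs_self _) hr0).trans
        (mul_le_of_le_one_right (abs_nonneg _) hr1)
    rw [mul_assoc (α * (Real.sqrt 2 - 1))]
    exact mul_le_mul_of_nonneg_left h3 (mul_nonneg hα.le (by linarith))
  have e6 : 0 ≤ η ^ 2 / 2 * lap h φ p ^ 2 := by positivity
  have e7 : 0 ≤ ξ / 2 * gradPair h ρ ρ p := by positivity
  have e8 : 0 ≤ Real.sqrt 2 * α / 2 * ρ p ^ 2 := by positivity
  simp only [hk] at e2 ⊢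
  linarith

theorem exists_lap_rightInverse (h : ℝ) :
    ∃ G : GF N →ₗ[ℝ] GF N, ∀ f ∈ LinearMap.range (lapLin (N := N) h), lap h (G f) = f := by
  obtain ⟨g, hg⟩ := (lapLin (N := N) h).rangeRestrict.exists_rightInverse_of_surjective
    (LinearMap.range_rangeRestrict _)
  obtain ⟨G, hG⟩ := LinearMap.exists_extend g
  refine ⟨G, fun f hf => ?_⟩
  have h1 : G f = g ⟨f, hf⟩ := LinearMap.congr_fun hG ⟨f, hf⟩
  rw [h1]
  exact congrArg Subtype.val (LinearMap.congr_fun hg ⟨f, hf⟩)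

/-- States with the masses of `(φn, ρn)` and a concentration in `[0, 1]`. -/
def admissible (h : ℝ) (φn ρn : GF N) : Set (GF N × GF N) :=
  {z | z.1 - φn ∈ LinearMap.range (lapLin (N := N) h) ∧
    z.2 - ρn ∈ LinearMap.range (lapLin (N := N) h) ∧ ∀ p, z.2 p ∈ Set.Icc (0 : ℝ) 1}

theorem isClosed_admissible (h : ℝ) (φn ρn : GF N) : IsClosed (admissible h φn ρn) := by
  have hr : IsClosed (LinearMap.range (lapLin (N := N) h) : Set (GF N)) :=
    Submodule.closed_of_finiteDimensional _
  have h01 : IsClosed {z : GF N × GF N | ∀ p, z.2 p ∈ Set.Icc (0 : ℝ) 1} := by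
    rw [Set.ofPred_forall]
    exact isClosed_iInter fun p =>
      isClosed_Icc.preimage ((continuous_apply p).comp continuous_snd)
  exact (hr.preimage (continuous_fst.sub continuous_const)).inter
    ((hr.preimage (continuous_snd.sub continuous_const)).inter h01)

theorem exists_energy_minimizer {G : GF N →ₗ[ℝ] GF N} {h τ ε ξ α β δ : ℝ} (η : ℝ)
    (hG : ∀ f ∈ LinearMap.range (lapLin (N := N) h), lap h (G f) = f) (hτ : 0 < τ) (hε : 0 < ε)
    (hξ : 0 < ξ) (hα : 0 < α) (hβ : 0 < β) (hδ : 0 < δ) {φn ρn : GF N}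
    (hne : (admissible h φn ρn).Nonempty) :
    ∃ z ∈ admissible h φn ρn, IsMinOn (fun z : GF N × GF N =>
      smoothEnergy G h τ ε η ξ α δ φn ρn z.1 z.2 + β * ∑ p, FH (z.2 p))
        (admissible h φn ρn) z := by
  set J : GF N × GF N → ℝ := fun z =>
    smoothEnergy G h τ ε η ξ α δ φn ρn z.1 z.2 + β * ∑ p, FH (z.2 p) with hJ
  have hJc : Continuous J := by
    have h1 := continuous_smoothEnergy G h τ ε η ξ α δ φn ρn
    have h2 := continuous_FH
    fun_prop
  obtain ⟨z₀, hz₀⟩ := hne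
  obtain ⟨C, hC⟩ := smoothEnergy_coercive η hG hτ hε hξ hα hδ φn ρn
  set R := J z₀ + C + β * ∑ _p : ZMod N × ZMod N, Real.log 2 with hR
  set b := Real.sqrt R with hb
  have hT : IsCompact (admissible h φn ρn ∩ {z | J z ≤ J z₀}) := by
    refine IsCompact.of_isClosed_subset
      ((isCompact_Icc (a := fun _ => 1 / 2 - b) (b := fun _ => 1 / 2 + b)).prod
        (isCompact_Icc (a := fun _ => 0) (b := fun _ => 1)))
      ((isClosed_admissible h φn ρn).inter (isClosed_le hJc continuous_const)) ?_
    rintro ⟨φ, ρ⟩ ⟨⟨hφ, hρ, h01⟩, hle⟩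
    have hφb : ∀ p, |φ p - 1 / 2| ≤ b := by
      intro p
      refine Real.abs_le_sqrt ?_
      have h1 := hC φ ρ hφ hρ h01
      have h2 : (φ p - 1 / 2) ^ 2 ≤ ∑ p, (φ p - 1 / 2) ^ 2 :=
        Finset.single_le_sum (f := fun p => (φ p - 1 / 2) ^ 2)
          (fun p _ => sq_nonneg _) (Finset.mem_univ p)
      have h3 : β * ∑ _p : ZMod N × ZMod N, -Real.log 2 ≤ β * ∑ p, FH (ρ p) :=
        mul_le_mul_of_nonneg_left (Finset.sum_le_sum fun p _ => neg_log_two_le_FH _) hβ.le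
      rw [Finset.sum_neg_distrib, mul_neg] at h3
      have h4 : smoothEnergy G h τ ε η ξ α δ φn ρn φ ρ + β * ∑ p, FH (ρ p) ≤ J z₀ := hle
      linarith
    refine ⟨⟨fun p => ?_, fun p => ?_⟩, ⟨fun p => (h01 p).1, fun p => (h01 p).2⟩⟩
    · have := (abs_le.1 (hφb p)).1
      simp only
      linarith
    · have := (abs_le.1 (hφb p)).2
      simp only
      linarith
  obtain ⟨z, ⟨hz, hzle⟩, hmin⟩ := hT.exists_isMinOn ⟨z₀, hz₀, le_refl (J z₀)⟩ hJc.continuousOn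
  refine ⟨z, hz, fun y hy => ?_⟩
  rcases le_total (J y) (J z₀) with hle | hle
  · exact hmin ⟨hy, hle⟩
  · exact le_trans hzle hle

end Energy

section Scheme

variable {N : ℕ} [NeZero N]

theorem scheme_solution_unique {h ε η ξ α β δ τ : ℝ} (hε : 0 < ε) (hξ : 0 < ξ)
    (hα : 0 < α) (hβ : 0 < β) (hδ : 0 < δ) (hτ : 0 < τ) {φn ρn φ₁ ρ₁ φ₂ ρ₂ : GF N}
    (h₁ : ∀ p, 0 < ρ₁ p ∧ ρ₁ p < 1) (h₂ : ∀ p, 0 < ρ₂ p ∧ ρ₂ p < 1)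
    (hφ₁ : φ₁ - φn = τ • lap h (muPhi h ε η α δ φn φ₁ ρ₁))
    (hρ₁ : ρ₁ - ρn = τ • lap h (muRho h ξ α β δ ρn φ₁ ρ₁))
    (hφ₂ : φ₂ - φn = τ • lap h (muPhi h ε η α δ φn φ₂ ρ₂))
    (hρ₂ : ρ₂ - ρn = τ • lap h (muRho h ξ α β δ ρn φ₂ ρ₂)) :
    φ₁ = φ₂ ∧ ρ₁ = ρ₂ := by
  have dissip : ∀ {f g μ ν : GF N}, f - g = τ • lap h (μ - ν) →
      ∑ p, (f - g) p * μ p - ∑ p, (f - g) p * ν p ≤ 0 := by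
    intro f g μ ν hfg
    rw [← Finset.sum_sub_distrib, hfg]
    have e : ∑ p, ((τ • lap h (μ - ν)) p * μ p - (τ • lap h (μ - ν)) p * ν p)
        = τ * ∑ p, (μ - ν) p * lap h (μ - ν) p := by
      rw [Finset.mul_sum]
      refine Finset.sum_congr rfl fun p _ => ?_
      simp only [Pi.smul_apply, smul_eq_mul, Pi.sub_apply]
      ring
    rw [e]
    exact mul_nonpos_of_nonneg_of_nonpos hτ.le (sum_mul_lap_self_nonpos h _)
  have dφ := dissip (f := φ₁) (g := φ₂) (μ := muPhi h ε η α δ φn φ₁ ρ₁)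
    (ν := muPhi h ε η α δ φn φ₂ ρ₂) (by rw [lap_sub, smul_sub, ← hφ₁, ← hφ₂]; abel)
  have dρ := dissip (f := ρ₁) (g := ρ₂) (μ := muRho h ξ α β δ ρn φ₁ ρ₁)
    (ν := muRho h ξ α β δ ρn φ₂ ρ₂) (by rw [lap_sub, smul_sub, ← hρ₁, ← hρ₂]; abel)
  rw [sum_mul_muPhi, sum_mul_muPhi, ← Finset.sum_sub_distrib] at dφ
  rw [sum_mul_muRho, sum_mul_muRho, ← Finset.sum_sub_distrib] at dρ
  have dsum := add_nonpos dφ dρ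
  rw [← Finset.sum_add_distrib] at dsum
  set c : GF N := fun p =>
    (1 / ε) * ((φ₁ p - 1 / 2 - (φ₂ p - 1 / 2)) * ((φ₁ p - 1 / 2) ^ 3 - (φ₂ p - 1 / 2) ^ 3))
    with hc
  set l : GF N := fun p => β * ((ρ₁ p - ρ₂ p) * ((Real.log (ρ₁ p) - Real.log (1 - ρ₁ p))
    - (Real.log (ρ₂ p) - Real.log (1 - ρ₂ p)))) with hl
  have hc0 : ∀ p, 0 ≤ c p := fun p =>
    mul_nonneg (by positivity) (sub_mul_cube_sub_cube_nonneg _ _)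
  have hlpos : ∀ p, ρ₁ p ≠ ρ₂ p → 0 < l p := by
    intro p hne
    refine mul_pos hβ ?_
    rcases lt_or_gt_of_ne hne with hlt | hlt
    · exact mul_pos_of_neg_of_neg (sub_neg.2 hlt)
        (sub_neg.2 (logit_strictMonoOn (h₁ p) (h₂ p) hlt))
    · exact mul_pos (sub_pos.2 hlt) (sub_pos.2 (logit_strictMonoOn (h₂ p) (h₁ p) hlt))
  have hl0 : ∀ p, 0 ≤ l p := by
    intro p
    by_cases he : ρ₁ p = ρ₂ p
    · simp [hl, he]
    · exact (hlpos p he).le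
  have hle : ∑ p, (c p + l p) ≤ 0 := by
    refine le_trans (Finset.sum_le_sum fun p _ => ?_) dsum
    have hcoup := mul_le_mul_of_nonneg_left
      (coupling_monotone h hδ φ₁ φ₂ ρ₁ ρ₂ p (h₂ p).1.le (h₂ p).2.le) hα.le
    have g1 := mul_nonneg hε.le (gradPair_self_nonneg h (φ₁ - φ₂) p)
    have g2 := mul_nonneg hξ.le (gradPair_self_nonneg h (ρ₁ - ρ₂) p)
    have g3 : 0 ≤ η ^ 2 * (lap h (φ₁ - φ₂) p) ^ 2 := by positivity
    have e1 := gradPair_sub_left h φ₁ φ₂ (φ₁ - φ₂) p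
    have e2 := gradPair_sub_left h ρ₁ ρ₂ (ρ₁ - ρ₂) p
    have e3 : lap h (φ₁ - φ₂) p = lap h φ₁ p - lap h φ₂ p := by rw [lap_sub]; rfl
    rw [e1] at g1 hcoup
    rw [e2] at g2
    rw [e3] at g3 ⊢
    simp only [hc, hl, Pi.sub_apply]
    have e4 : α / δ = α * (1 / δ) := by ring
    rw [e4]
    linarith
  have hzero := (Finset.sum_eq_zero_iff_of_nonneg fun p _ => add_nonneg (hc0 p) (hl0 p)).1
    (le_antisymm hle (Finset.sum_nonneg fun p _ => add_nonneg (hc0 p) (hl0 p)))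
  constructor <;> funext p <;> have hp := hzero p (Finset.mem_univ p)
  · have hcp : c p = 0 := le_antisymm (by linarith [hl0 p]) (hc0 p)
    have := (mul_eq_zero.1 hcp).resolve_left (by positivity)
    linarith [eq_of_sub_mul_cube_sub_cube_eq_zero this]
  · by_contra hne
    linarith [hlpos p hne, hc0 p]

open Filter Topology in
theorem exists_scheme_solution {h ε ξ α β δ τ m : ℝ} (η : ℝ) (hh : h ≠ 0) (hε : 0 < ε)
    (hξ : 0 < ξ) (hα : 0 < α) (hβ : 0 < β) (hδ : 0 < δ) (hτ : 0 < τ) (φn : GF N) {ρn : GF N}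
    (hm0 : 0 < m) (hm1 : m < 1) (hm : ∑ p, (m - ρn p) = 0) :
    ∃ φ ρ : GF N, (∀ p, 0 < ρ p ∧ ρ p < 1) ∧
      φ - φn = τ • lap h (muPhi h ε η α δ φn φ ρ) ∧
      ρ - ρn = τ • lap h (muRho h ξ α β δ ρn φ ρ) := by
  obtain ⟨G, hG⟩ := exists_lap_rightInverse (N := N) h
  have hmr : (fun _ => m) - ρn ∈ LinearMap.range (lapLin (N := N) h) := mem_range_lapLin hh hm
  obtain ⟨⟨φ, ρ⟩, ⟨hφ, hρ, h01⟩, hmin⟩ := exists_energy_minimizer (β := β) η hG hτ hε hξ hα hβ hδ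
    (φn := φn) (ρn := ρn)
    ⟨(φn, fun _ => m), by simp, hmr, fun _ => ⟨hm0.le, hm1.le⟩⟩
  simp only at hφ hρ h01
  have hmin' : ∀ v w : GF N, (∀ p, (ρ + lap h w) p ∈ Set.Icc (0 : ℝ) 1) →
      smoothEnergy G h τ ε η ξ α δ φn ρn φ ρ + β * ∑ p, FH (ρ p)
        ≤ smoothEnergy G h τ ε η ξ α δ φn ρn (φ + lap h v) (ρ + lap h w)
          + β * ∑ p, FH ((ρ + lap h w) p) := by
    intro v w hw
    refine hmin (a := (φ + lap h v, ρ + lap h w)) ⟨?_, ?_, hw⟩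
    · rw [add_sub_right_comm]
      exact add_mem hφ ⟨v, rfl⟩
    · rw [add_sub_right_comm]
      exact add_mem hρ ⟨w, rfl⟩
  have hint : ∀ p, 0 < ρ p ∧ ρ p < 1 := by
    obtain ⟨w, hw⟩ : (fun _ => m) - ρ ∈ LinearMap.range (lapLin (N := N) h) := by
      rw [← sub_sub_sub_cancel_right _ _ ρn]
      exact sub_mem hmr hρ
    have hwp : ∀ (t : ℝ) p, (ρ + t • lap h w) p = ρ p + t * (m - ρ p) := fun t p =>
      congrArg (fun x => ρ p + t * x) (congrFun hw p)
    refine interior_of_entropy_min h01 hm0 hm1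
      (hasDerivAt_smoothEnergy_line hG τ ε η ξ α hδ (0 : GF N) w hφ hρ) hβ fun t ht => ?_
    have h1 := hmin' (t • 0) (t • w)
    simp only [lap_smul, hwp] at h1
    simp only [zero_smul, add_zero]
    refine h1 fun p => ?_
    have hp := h01 p
    constructor
    · nlinarith [hp.1, hp.2, ht.1, ht.2, mul_nonneg (sub_nonneg.2 ht.2) hp.1, mul_pos ht.1 hm0]
    · nlinarith [hp.1, hp.2, ht.1, ht.2,
        mul_nonneg (sub_nonneg.2 ht.2) (sub_nonneg.2 hp.2), mul_pos ht.1 (sub_pos.2 hm1)]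
  refine ⟨φ, ρ, hint, ?_⟩
  set X : GF N := lap h (muPhi h ε η α δ φn φ ρ) - (1 / τ) • (φ - φn) with hX
  set Y : GF N := lap h (muRho h ξ α β δ ρn φ ρ) - (1 / τ) • (ρ - ρn) with hY
  have hcrit : ∑ p, X p * X p + ∑ p, Y p * Y p = 0 := by
    have hlocal : IsLocalMin (fun t : ℝ => smoothEnergy G h τ ε η ξ α δ φn ρn
        (φ + t • lap h X) (ρ + t • lap h Y) + β * ∑ p, FH ((ρ + t • lap h Y) p)) 0 := by
      have hev : ∀ᶠ t : ℝ in 𝓝 0, ∀ p, (ρ + t • lap h Y) p ∈ Set.Icc (0 : ℝ) 1 := by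
        refine eventually_all.2 fun p => ?_
        have hcont := (hasDerivAt_line ρ (lap h Y) p).continuousAt
        refine hcont.eventually_mem (Icc_mem_nhds ?_ ?_)
        · simpa using (hint p).1
        · simpa using (hint p).2
      filter_upwards [hev] with t ht
      have h1 := hmin' (t • X) (t • Y)
      simp only [lap_smul] at h1
      simpa only [zero_smul, add_zero] using h1 ht
    have hFH : HasDerivAt (fun t : ℝ => β * ∑ p, FH ((ρ + t • lap h Y) p))
        (β * ∑ p, (Real.log (ρ p) - Real.log (1 - ρ p)) * lap h Y p) 0 := by
      refine (HasDerivAt.fun_sum fun p _ => ?_).const_mul β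
      exact (hasDerivAt_FH (hint p).1 (hint p).2).comp_of_eq 0 (hasDerivAt_line ρ (lap h Y) p)
        (by simp)
    have hzero := hlocal.hasDerivAt_eq_zero
      ((hasDerivAt_smoothEnergy_line hG τ ε η ξ α hδ X Y hφ hρ).add hFH)
    have hmu : ∑ p, lap h Y p * muRho h ξ α 0 δ ρn φ ρ p
        + β * ∑ p, (Real.log (ρ p) - Real.log (1 - ρ p)) * lap h Y p
        = ∑ p, lap h Y p * muRho h ξ α β δ ρn φ ρ p := by
      rw [Finset.mul_sum, ← Finset.sum_add_distrib]
      refine Finset.sum_congr rfl fun p _ => ?_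
      simp only [muRho]
      ring
    have hparts : ∀ Z μ f : GF N, Z = lap h μ - (1 / τ) • f →
        ∑ p, Z p * Z p = -(1 / τ) * ∑ p, Z p * f p + ∑ p, lap h Z p * μ p := by
      intro Z μ f hZ
      simp_rw [mul_comm (lap h Z _)]
      rw [sum_mul_lap_comm, Finset.mul_sum, ← Finset.sum_add_distrib]
      refine Finset.sum_congr rfl fun p _ => ?_
      have : Z p = lap h μ p - 1 / τ * f p := congrFun hZ p
      linear_combination Z p * this
    rw [hparts X _ _ hX, hparts Y _ _ hY]
    linarith
  have hsq : ∀ Z : GF N, 0 ≤ ∑ p, Z p * Z p := fun Z =>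
    Finset.sum_nonneg fun p _ => mul_self_nonneg _
  have hvanish : ∀ {Z μ f : GF N}, Z = lap h μ - (1 / τ) • f → ∑ p, Z p * Z p = 0 →
      f = τ • lap h μ := by
    intro Z μ f hZ h0
    rw [Finset.sum_eq_zero_iff_of_nonneg fun p _ => mul_self_nonneg _] at h0
    funext p
    have h1 : Z p = lap h μ p - 1 / τ * f p := congrFun hZ p
    rw [mul_self_eq_zero.1 (h0 p (Finset.mem_univ p))] at h1
    rw [Pi.smul_apply, smul_eq_mul, sub_eq_zero.1 h1.symm]
    field_simp
  exact ⟨hvanish hX (by linarith [hsq X, hsq Y]), hvanish hY (by linarith [hsq X, hsq Y])⟩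

end Scheme

/-- positivity-preserving unique solvability of the convex splitting scheme:
given grid data `(φⁿ, ρⁿ)` with mean of `ρⁿ` in `(0,1)`, there exists a unique pair
`(φⁿ⁺¹, ρⁿ⁺¹)` with `0 < ρⁿ⁺¹ < 1` pointwise solving the scheme. -/
theorem convex_splitting_scheme_unique_solvable_positive
    (L : ℝ) (hL : 0 < L) (N : ℕ) [NeZero N] (h : ℝ) (hh : h = L / N)
    (ε η ξ α β δ M Δt : ℝ)
    (hε : 0 < ε) (hη : 0 < η) (hξ : 0 < ξ) (hα : 0 < α) (hβ : 0 < β)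
    (hδ : 0 < δ) (hM : 0 < M) (hΔt : 0 < Δt)
    (φn ρn : GF N)
    (hmean0 : 0 < (1 / (N : ℝ) ^ 2) * ∑ p : ZMod N × ZMod N, ρn p)
    (hmean1 : (1 / (N : ℝ) ^ 2) * ∑ p : ZMod N × ZMod N, ρn p < 1) :
    ∃! z : GF N × GF N,
      (∀ p, 0 < z.2 p ∧ z.2 p < 1)
      ∧ (∀ p, (z.1 p - φn p) / Δt = M * lap h (muPhi h ε η α δ φn z.1 z.2) p)
      ∧ (∀ p, (z.2 p - ρn p) / Δt = M * lap h (muRho h ξ α β δ ρn z.1 z.2) p) := by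
  have hN : (0 : ℝ) < N := Nat.cast_pos.2 (NeZero.pos N)
  have hh0 : h ≠ 0 := by rw [hh]; positivity
  have hτ : 0 < M * Δt := mul_pos hM hΔt
  have hstep : ∀ u un μ : GF N,
      (∀ p, (u p - un p) / Δt = M * lap h μ p) ↔ u - un = (M * Δt) • lap h μ := by
    intro u un μ
    rw [funext_iff]
    refine forall_congr' fun p => ?_
    rw [div_eq_iff hΔt.ne', Pi.sub_apply, Pi.smul_apply, smul_eq_mul, mul_right_comm]
  simp only [hstep]
  have hm : ∑ p : ZMod N × ZMod N, ((1 / (N : ℝ) ^ 2) * ∑ p, ρn p - ρn p) = 0 := by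
    rw [Finset.sum_sub_distrib, Finset.sum_const, Finset.card_univ, Fintype.card_prod, ZMod.card,
      nsmul_eq_mul]
    push_cast
    field_simp
    ring
  obtain ⟨φ, ρ, hint, hφ, hρ⟩ :=
    exists_scheme_solution η hh0 hε hξ hα hβ hδ hτ φn hmean0 hmean1 hm
  refine ⟨(φ, ρ), ⟨hint, hφ, hρ⟩, ?_⟩
  rintro ⟨φ', ρ'⟩ ⟨hint', hφ', hρ'⟩
  obtain ⟨h1, h2⟩ :=
    scheme_solution_unique hε hξ hα hβ hδ hτ hint' hint hφ' hρ' hφ hρ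
  exact Prod.ext h1 h2
end
end
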